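/- Let q ≥ 1 be an integer and let (s_j)_{j=0}^∞ be a Stieltjes positive definite sequence of complex q×q matrices. Then for all k ∈ ℕ₀, all m ∈ {0, …, k}, and all z ∈ ℂ∖{0}: 𝕃_k = 𝒫_m · 𝕃_{k−m}^{(2m)} · 𝒫_m^{−1} = 𝐐_m(z) · 𝕄_{k−m}^{(2m+1)}(z) · [𝐐_m(z)]^{−1}, 𝕄_k(z) = 𝒫_m · 𝕄_{k−m}^{(2m)}(z) · 𝒫_m^{−1}, and 𝕄_{k+1}(z) = 𝐐_m(z) · 𝕃_{k−m}^{(2m+1)} · [𝐐_m(z)]^{−1}. -/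

import Mathlib

open Matrix
open scoped ComplexOrder

noncomputable section

/-- The space of complex `q × q` matrices. -/
abbrev Mq (q : ℕ) := Matrix (Fin q) (Fin q) ℂ

/-- The space of complex `2q × 2q` matrices, written in `q × q` blocks. -/
abbrev M2q (q : ℕ) := Matrix (Fin q ⊕ Fin q) (Fin q ⊕ Fin q) ℂ

/-- Block Hankel matrix `H_n = (s_{j+k})_{j,k=0}^n`. -/
def Hmat (q : ℕ) (s : ℕ → Mq q) (n : ℕ) :
    Matrix (Fin (n + 1) × Fin q) (Fin (n + 1) × Fin q) ℂ :=
  Matrix.of fun p r => s (p.1.1 + r.1.1) p.2 r.2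

/-- Block Hankel matrix `K_n = (s_{j+k+1})_{j,k=0}^n`. -/
def Kmat (q : ℕ) (s : ℕ → Mq q) (n : ℕ) :
    Matrix (Fin (n + 1) × Fin q) (Fin (n + 1) × Fin q) ℂ :=
  Matrix.of fun p r => s (p.1.1 + r.1.1 + 1) p.2 r.2

/-- A sequence of complex `q × q` matrices is Stieltjes positive definite if all the
block Hankel matrices `H_n` and `K_n` are positive definite (in particular Hermitian). -/
def IsStieltjesPD (q : ℕ) (s : ℕ → Mq q) : Prop :=
  ∀ n : ℕ, (Hmat q s n).PosDef ∧ (Kmat q s n).PosDef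

/-- Even Stieltjes parameters `𝔮_{2k}` (Schur complements `L_k`). -/
def qEven (q : ℕ) (s : ℕ → Mq q) : ℕ → Mq q
  | 0 => s 0
  | k + 1 =>
      s (2 * (k + 1)) -
        (Matrix.of fun (a : Fin q) (r : Fin (k + 1) × Fin q) => s (k + 1 + r.1.1) a r.2) *
          (Hmat q s k)⁻¹ *
          (Matrix.of fun (p : Fin (k + 1) × Fin q) (b : Fin q) => s (k + 1 + p.1.1) p.2 b)

/-- Odd Stieltjes parameters `𝔮_{2k+1}` (Schur complements `Λ_k`). -/
def qOdd (q : ℕ) (s : ℕ → Mq q) : ℕ → Mq q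
  | 0 => s 1
  | k + 1 =>
      s (2 * (k + 1) + 1) -
        (Matrix.of fun (a : Fin q) (r : Fin (k + 1) × Fin q) => s (k + 2 + r.1.1) a r.2) *
          (Kmat q s k)⁻¹ *
          (Matrix.of fun (p : Fin (k + 1) × Fin q) (b : Fin q) => s (k + 2 + p.1.1) p.2 b)

/-- Stieltjes parametrization `𝔮_j`. -/
def qpar (q : ℕ) (s : ℕ → Mq q) (j : ℕ) : Mq q :=
  if j % 2 = 0 then qEven q s (j / 2) else qOdd q s (j / 2)

/-- Reciprocal sequence `s^♯`. -/
def reciprocal (q : ℕ) (s : ℕ → Mq q) : ℕ → Mq q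
  | 0 => (s 0)⁻¹
  | j + 1 =>
      -(s 0)⁻¹ *
        ∑ l ∈ (Finset.range (j + 1)).attach, s (j + 1 - l.1) * reciprocal q s l.1
  decreasing_by exact Finset.mem_range.mp l.2

/-- First Kátětov transform `s^{(1)}_j = −s_0 s_{j+1}^♯ s_0`. -/
def katetov1 (q : ℕ) (s : ℕ → Mq q) : ℕ → Mq q :=
  fun j => -(s 0) * reciprocal q s (j + 1) * s 0

/-- `ℓ`-th Kátětov transform (the `ℓ`-fold iterate of the first Kátětov transform). -/
def katetov (q : ℕ) (ℓ : ℕ) (s : ℕ → Mq q) : ℕ → Mq q :=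
  (katetov1 q)^[ℓ] s

/-- `v_k = col(I_q, 0_{kq×q})`. -/
def vcol (q k : ℕ) : Matrix (Fin (k + 1) × Fin q) (Fin q) ℂ :=
  Matrix.of fun p b => if p.1.1 = 0 ∧ p.2 = b then 1 else 0

/-- `y_{0,k} = col(s_0, …, s_k)`. -/
def ycol (q : ℕ) (s : ℕ → Mq q) (k : ℕ) : Matrix (Fin (k + 1) × Fin q) (Fin q) ℂ :=
  Matrix.of fun p b => s p.1.1 p.2 b

/-- Dyukarev–Stieltjes parameters `𝔐_k`. -/
def DSM (q : ℕ) (s : ℕ → Mq q) : ℕ → Mq q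
  | 0 => (s 0)⁻¹
  | k + 1 =>
      (vcol q (k + 1))ᴴ * (Hmat q s (k + 1))⁻¹ * vcol q (k + 1) -
        (vcol q k)ᴴ * (Hmat q s k)⁻¹ * vcol q k

/-- Dyukarev–Stieltjes parameters `𝔏_k`. -/
def DSL (q : ℕ) (s : ℕ → Mq q) : ℕ → Mq q
  | 0 => s 0 * (s 1)⁻¹ * s 0
  | k + 1 =>
      (ycol q s (k + 1))ᴴ * (Kmat q s (k + 1))⁻¹ * ycol q s (k + 1) -
        (ycol q s k)ᴴ * (Kmat q s k)⁻¹ * ycol q s k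

/-- Ordered product `A_0 A_1 ⋯ A_n`. -/
def oprod {α : Type*} [Monoid α] (f : ℕ → α) (n : ℕ) : α :=
  ((List.range (n + 1)).map f).prod

/-- Block shift `T_n = (δ_{j,k+1} I_q)_{j,k=0}^n`. -/
def Tmat (q n : ℕ) : Matrix (Fin (n + 1) × Fin q) (Fin (n + 1) × Fin q) ℂ :=
  Matrix.of fun p r => if p.1.1 = r.1.1 + 1 ∧ p.2 = r.2 then 1 else 0

/-- `R_n(z) = (I_{(n+1)q} − z T_n)⁻¹`. -/
def Rmat (q n : ℕ) (z : ℂ) : Matrix (Fin (n + 1) × Fin q) (Fin (n + 1) × Fin q) ℂ :=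
  (1 - z • Tmat q n)⁻¹

/-- `u_0 = 0`, `u_n = col(0_{q×q}, −y_{0,n−1})`. -/
def ucol (q : ℕ) (s : ℕ → Mq q) (n : ℕ) : Matrix (Fin (n + 1) × Fin q) (Fin q) ℂ :=
  Matrix.of fun p b => if p.1.1 = 0 then 0 else -(s (p.1.1 - 1) p.2 b)

/-- `col(−H_n⁻¹ y_{n+1,2n+1}, I_q)` of size `(n+2)q × q`. -/
def colH (q : ℕ) (s : ℕ → Mq q) (n : ℕ) : Matrix (Fin (n + 2) × Fin q) (Fin q) ℂ :=
  Matrix.of fun p b =>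
    if h : p.1.1 < n + 1 then
      (-((Hmat q s n)⁻¹ *
          Matrix.of fun (r : Fin (n + 1) × Fin q) (c : Fin q) => s (n + 1 + r.1.1) r.2 c))
        (⟨p.1.1, h⟩, p.2) b
    else if p.2 = b then 1 else 0

/-- `col(−K_n⁻¹ y_{n+2,2n+2}, I_q)` of size `(n+2)q × q`. -/
def colK (q : ℕ) (s : ℕ → Mq q) (n : ℕ) : Matrix (Fin (n + 2) × Fin q) (Fin q) ℂ :=
  Matrix.of fun p b =>
    if h : p.1.1 < n + 1 then
      (-((Kmat q s n)⁻¹ *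
          Matrix.of fun (r : Fin (n + 1) × Fin q) (c : Fin q) => s (n + 2 + r.1.1) r.2 c))
        (⟨p.1.1, h⟩, p.2) b
    else if p.2 = b then 1 else 0

/-- `z_{0,n} = row(s_0, …, s_n)`. -/
def zrow (q : ℕ) (s : ℕ → Mq q) (n : ℕ) : Matrix (Fin q) (Fin (n + 1) × Fin q) ℂ :=
  Matrix.of fun a r => s r.1.1 a r.2

/-- Orthogonal matrix polynomials `P_n`. -/
def Ppoly (q : ℕ) (s : ℕ → Mq q) : ℕ → ℂ → Mq q
  | 0, _ => 1
  | n + 1, z => (vcol q (n + 1))ᴴ * (Rmat q (n + 1) (starRingEnd ℂ z))ᴴ * colH q s n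

/-- Second kind matrix polynomials `Q_n`. -/
def Qpoly (q : ℕ) (s : ℕ → Mq q) : ℕ → ℂ → Mq q
  | 0, _ => 0
  | n + 1, z => -((ucol q s (n + 1))ᴴ * (Rmat q (n + 1) (starRingEnd ℂ z))ᴴ * colH q s n)

/-- Matrix polynomials `P̂_n`. -/
def Phat (q : ℕ) (s : ℕ → Mq q) : ℕ → ℂ → Mq q
  | 0, _ => 1
  | n + 1, z => (vcol q (n + 1))ᴴ * (Rmat q (n + 1) (starRingEnd ℂ z))ᴴ * colK q s n

/-- Matrix polynomials `Q̂_n`. -/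
def Qhat (q : ℕ) (s : ℕ → Mq q) : ℕ → ℂ → Mq q
  | 0, _ => s 0
  | n + 1, z => zrow q s (n + 1) * (Rmat q (n + 1) (starRingEnd ℂ z))ᴴ * colK q s n

/-- `α_n(z)`. -/
def alphaP (q : ℕ) (s : ℕ → Mq q) (n : ℕ) (z : ℂ) : Mq q :=
  1 - z • ((ucol q s n)ᴴ * (Rmat q n (starRingEnd ℂ z))ᴴ * (Hmat q s n)⁻¹ * vcol q n)

/-- `γ_n(z)`. -/
def gammaP (q : ℕ) (s : ℕ → Mq q) (n : ℕ) (z : ℂ) : Mq q :=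
  -(z • ((vcol q n)ᴴ * (Rmat q n (starRingEnd ℂ z))ᴴ * (Hmat q s n)⁻¹ * vcol q n))

/-- `β_n(z)`. -/
def betaP (q : ℕ) (s : ℕ → Mq q) : ℕ → ℂ → Mq q
  | 0, _ => 0
  | n + 1, z => (ycol q s n)ᴴ * (Rmat q n (starRingEnd ℂ z))ᴴ * (Kmat q s n)⁻¹ * ycol q s n

/-- `δ_n(z)`. -/
def deltaP (q : ℕ) (s : ℕ → Mq q) : ℕ → ℂ → Mq q
  | 0, _ => 1
  | n + 1, z =>
      1 + z • ((vcol q n)ᴴ * (Rmat q n (starRingEnd ℂ z))ᴴ * (Kmat q s n)⁻¹ * ycol q s n)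

/-- The resolvent matrices `U_m(z)`. -/
def Umat (q : ℕ) (s : ℕ → Mq q) (m : ℕ) (z : ℂ) : M2q q :=
  if m % 2 = 0 then
    Matrix.fromBlocks (alphaP q s (m / 2) z) (betaP q s (m / 2) z)
      (gammaP q s (m / 2) z) (deltaP q s (m / 2) z)
  else
    Matrix.fromBlocks (alphaP q s (m / 2) z) (betaP q s (m / 2 + 1) z)
      (gammaP q s (m / 2) z) (deltaP q s (m / 2 + 1) z)

/-- `𝕄_k(z) = [[I, 0], [−z𝔐_k, I]]`. -/
def MM (q : ℕ) (s : ℕ → Mq q) (k : ℕ) (z : ℂ) : M2q q :=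
  Matrix.fromBlocks 1 0 (-(z • DSM q s k)) 1

/-- `𝕃_k = [[I, 𝔏_k], [0, I]]`. -/
def LL (q : ℕ) (s : ℕ → Mq q) (k : ℕ) : M2q q :=
  Matrix.fromBlocks 1 (DSL q s k) 0 1

/-- `𝒫_n = diag([P_n(0)]^{−*}, P_n(0))`. -/
def PPmat (q : ℕ) (s : ℕ → Mq q) (n : ℕ) : M2q q :=
  Matrix.fromBlocks (((Ppoly q s n 0)⁻¹)ᴴ) 0 0 (Ppoly q s n 0)

/-- `𝐐_n(z) = [[0, Q̂_n(0)], [−z[Q̂_n(0)]^{−*}, 0]]`. -/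
def QQgen (q : ℕ) (s : ℕ → Mq q) (n : ℕ) (z : ℂ) : M2q q :=
  Matrix.fromBlocks 0 (Qhat q s n 0) (-(z • ((Qhat q s n 0)⁻¹)ᴴ)) 0

/-- `𝐐_0^{(ℓ)}(z) = [[0, s_0^{(ℓ)}], [−z(s_0^{(ℓ)})⁻¹, 0]]`. -/
def QQ0 (q : ℕ) (s : ℕ → Mq q) (ℓ : ℕ) (z : ℂ) : M2q q :=
  Matrix.fromBlocks 0 (katetov q ℓ s 0) (-(z • (katetov q ℓ s 0)⁻¹)) 0

/-- `𝒬_m(z) = 𝐐_0^{(0)}(z) ⋯ 𝐐_0^{(m)}(z)`. -/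
def Qprod (q : ℕ) (s : ℕ → Mq q) (m : ℕ) (z : ℂ) : M2q q :=
  oprod (fun ℓ => QQ0 q s ℓ z) m

/-! ### Block matrices given by kernels -/

/-- Block matrix with blocks `A i j`. -/
def blk {q : ℕ} (A : ℕ → ℕ → Mq q) (n : ℕ) :
    Matrix (Fin (n + 1) × Fin q) (Fin (n + 1) × Fin q) ℂ :=
  Matrix.of fun p r => A p.1.1 r.1.1 p.2 r.2

/-- Block column with blocks `C i`. -/
def bc {q : ℕ} (C : ℕ → Mq q) (n : ℕ) : Matrix (Fin (n + 1) × Fin q) (Fin q) ℂ :=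
  Matrix.of fun p b => C p.1.1 p.2 b

/-- Block row with blocks `C i`. -/
def br {q : ℕ} (C : ℕ → Mq q) (n : ℕ) : Matrix (Fin q) (Fin (n + 1) × Fin q) ℂ :=
  Matrix.of fun a r => C r.1.1 a r.2

/-- Upper triangular block Toeplitz kernel. -/
def up {q : ℕ} (s : ℕ → Mq q) (i j : ℕ) : Mq q := if i ≤ j then s (j - i) else 0

/-- Lower triangular block Toeplitz kernel. -/
def lo {q : ℕ} (s : ℕ → Mq q) (i j : ℕ) : Mq q := if j ≤ i then s (i - j) else 0

/-- Block diagonal kernel. -/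
def dgk {q : ℕ} (a : Mq q) (i j : ℕ) : Mq q := if i = j then a else 0

lemma blk_congr {q : ℕ} {A B : ℕ → ℕ → Mq q} {n : ℕ}
    (h : ∀ i j, i ≤ n → j ≤ n → A i j = B i j) : blk A n = blk B n := by
  ext ⟨i, a⟩ ⟨j, b⟩
  simp only [blk, Matrix.of_apply]
  rw [h _ _ (by omega) (by omega)]

lemma bc_congr {q : ℕ} {A B : ℕ → Mq q} {n : ℕ}
    (h : ∀ i, i ≤ n → A i = B i) : bc A n = bc B n := by
  ext ⟨i, a⟩ b
  simp only [bc, Matrix.of_apply]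
  rw [h _ (by omega)]

lemma bc_inj {q : ℕ} {A B : ℕ → Mq q} {n : ℕ} (h : bc A n = bc B n) :
    ∀ i, i ≤ n → A i = B i := by
  intro i hi
  ext a b
  have := congrFun (congrFun h (⟨i, by omega⟩, a)) b
  simpa [bc] using this

lemma blk_mul {q : ℕ} (A B : ℕ → ℕ → Mq q) (n : ℕ) :
    blk A n * blk B n = blk (fun i k => ∑ j ∈ Finset.range (n + 1), A i j * B j k) n := by
  ext ⟨i, a⟩ ⟨j, b⟩
  simp only [blk, Matrix.mul_apply, Matrix.of_apply, Fintype.sum_prod_type, Matrix.sum_apply]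
  rw [Finset.sum_range]

lemma blk_mul_bc {q : ℕ} (A : ℕ → ℕ → Mq q) (C : ℕ → Mq q) (n : ℕ) :
    blk A n * bc C n = bc (fun i => ∑ j ∈ Finset.range (n + 1), A i j * C j) n := by
  ext ⟨i, a⟩ b
  simp only [blk, bc, Matrix.mul_apply, Matrix.of_apply, Fintype.sum_prod_type, Matrix.sum_apply]
  rw [Finset.sum_range]

lemma br_mul_blk {q : ℕ} (A : ℕ → ℕ → Mq q) (C : ℕ → Mq q) (n : ℕ) :
    br C n * blk A n = br (fun i => ∑ j ∈ Finset.range (n + 1), C j * A j i) n := by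
  ext a ⟨i, b⟩
  simp only [blk, br, Matrix.mul_apply, Matrix.of_apply, Fintype.sum_prod_type, Matrix.sum_apply]
  rw [Finset.sum_range]

lemma br_mul_bc {q : ℕ} (A C : ℕ → Mq q) (n : ℕ) :
    br A n * bc C n = ∑ j ∈ Finset.range (n + 1), A j * C j := by
  ext a b
  simp only [bc, br, Matrix.mul_apply, Matrix.of_apply, Fintype.sum_prod_type, Matrix.sum_apply]
  rw [Finset.sum_range]

lemma blk_neg {q : ℕ} (A : ℕ → ℕ → Mq q) (n : ℕ) :
    -blk A n = blk (fun i j => - A i j) n := by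
  ext ⟨i, a⟩ ⟨j, b⟩
  simp [blk]

lemma blk_conjTranspose {q : ℕ} (A : ℕ → ℕ → Mq q) (n : ℕ) :
    (blk A n)ᴴ = blk (fun i j => (A j i)ᴴ) n := by
  ext ⟨i, a⟩ ⟨j, b⟩
  simp [blk]

lemma br_conjTranspose {q : ℕ} (A : ℕ → Mq q) (n : ℕ) :
    (br A n)ᴴ = bc (fun i => (A i)ᴴ) n := by
  ext ⟨i, a⟩ b
  simp [br, bc]

lemma bc_conjTranspose {q : ℕ} (A : ℕ → Mq q) (n : ℕ) :
    (bc A n)ᴴ = br (fun i => (A i)ᴴ) n := by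
  ext b ⟨i, a⟩
  simp [br, bc]

lemma blk_one {q : ℕ} (n : ℕ) : blk (dgk (1 : Mq q)) n = 1 := by
  ext ⟨i, a⟩ ⟨j, b⟩
  simp only [blk, dgk, Matrix.of_apply, Matrix.one_apply, Prod.mk.injEq, Fin.ext_iff]
  by_cases h : i.1 = j.1 <;> simp [h, Matrix.one_apply, Fin.ext_iff]

lemma sum_dgk_left {q : ℕ} (a : Mq q) (f : ℕ → Mq q) {n i : ℕ} (hi : i ≤ n) :
    ∑ j ∈ Finset.range (n + 1), dgk a i j * f j = a * f i := by
  rw [Finset.sum_eq_single i]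
  · simp [dgk]
  · intro b _ hb
    simp [dgk, hb.symm]
  · intro h; exact absurd (Finset.mem_range.mpr (by omega)) h

lemma sum_dgk_right {q : ℕ} (a : Mq q) (f : ℕ → Mq q) {n i : ℕ} (hi : i ≤ n) :
    ∑ j ∈ Finset.range (n + 1), f j * dgk a j i = f i * a := by
  rw [Finset.sum_eq_single i]
  · simp [dgk]
  · intro b _ hb
    simp [dgk, hb]
  · intro h; exact absurd (Finset.mem_range.mpr (by omega)) h

lemma dg_mul_blk {q : ℕ} (a : Mq q) (A : ℕ → ℕ → Mq q) (n : ℕ) :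
    blk (dgk a) n * blk A n = blk (fun i j => a * A i j) n := by
  rw [blk_mul]
  exact blk_congr fun i j hi hj => sum_dgk_left a (fun k => A k j) hi

lemma blk_mul_dg {q : ℕ} (a : Mq q) (A : ℕ → ℕ → Mq q) (n : ℕ) :
    blk A n * blk (dgk a) n = blk (fun i j => A i j * a) n := by
  rw [blk_mul]
  exact blk_congr fun i j hi hj => sum_dgk_right a (fun k => A i k) hj

lemma dg_mul_bc {q : ℕ} (a : Mq q) (C : ℕ → Mq q) (n : ℕ) :
    blk (dgk a) n * bc C n = bc (fun i => a * C i) n := by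
  rw [blk_mul_bc]
  exact bc_congr fun i hi => sum_dgk_left a C hi

lemma br_mul_dg {q : ℕ} (a : Mq q) (C : ℕ → Mq q) (n : ℕ) :
    br C n * blk (dgk a) n = br (fun i => C i * a) n := by
  have := bc_congr (n := n) (A := fun i => (∑ j ∈ Finset.range (n + 1), C j * dgk a j i)ᴴ)
    (B := fun i => (C i * a)ᴴ) (fun i hi => by rw [sum_dgk_right a C hi])
  rw [br_mul_blk]
  rw [← br_conjTranspose, ← br_conjTranspose] at this
  exact Matrix.conjTranspose_injective this

lemma dg_mul_dg {q : ℕ} (a b : Mq q) (n : ℕ) :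
    blk (dgk a) n * blk (dgk b) n = blk (dgk (a * b)) n := by
  rw [dg_mul_blk]
  refine blk_congr fun i j _ _ => ?_
  by_cases h : i = j <;> simp [dgk, h]

lemma dg_conjTranspose {q : ℕ} (a : Mq q) (n : ℕ) :
    (blk (dgk a) n)ᴴ = blk (dgk aᴴ) n := by
  rw [blk_conjTranspose]
  refine blk_congr fun i j _ _ => ?_
  by_cases h : i = j
  · simp [dgk, h]
  · simp [dgk, h, Ne.symm h]

/-! ### Reciprocal sequences -/

lemma sum_trunc {q : ℕ} (f : ℕ → Mq q) {n i : ℕ} (hi : i ≤ n) :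
    ∑ j ∈ Finset.range (n + 1), (if j ≤ i then f j else 0) =
      ∑ j ∈ Finset.range (i + 1), f j := by
  rw [← Finset.sum_filter]
  refine Finset.sum_congr ?_ fun _ _ => rfl
  ext x
  simp only [Finset.mem_filter, Finset.mem_range]
  omega

lemma conv_recip {q : ℕ} (s : ℕ → Mq q) (h0 : IsUnit (s 0).det) (N : ℕ) :
    ∑ c ∈ Finset.range (N + 1), s (N - c) * reciprocal q s c = if N = 0 then 1 else 0 := by
  cases N with
  | zero => simp [reciprocal, Matrix.mul_nonsing_inv _ h0]
  | succ N =>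
    rw [Finset.sum_range_succ]
    have : reciprocal q s (N + 1) = -(s 0)⁻¹ * ∑ l ∈ Finset.range (N + 1),
        s (N + 1 - l) * reciprocal q s l := by
      rw [reciprocal]
      congr 1
      exact Finset.sum_attach (Finset.range (N + 1))
        (fun l => s (N + 1 - l) * reciprocal q s l)
    rw [this]
    simp [← mul_assoc, Matrix.mul_nonsing_inv _ h0]

lemma sum_up_right {q : ℕ} (r : ℕ → Mq q) (f : ℕ → Mq q) {n k : ℕ} (hk : k ≤ n) :
    ∑ j ∈ Finset.range (n + 1), f j * up r j k =
      ∑ c ∈ Finset.range (k + 1), f (k - c) * r c := by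
  have h1 : ∀ j ∈ Finset.range (n + 1), f j * up r j k =
      if j ≤ k then f j * r (k - j) else 0 := by
    intro j _
    by_cases h : j ≤ k <;> simp [up, h]
  rw [Finset.sum_congr rfl h1, sum_trunc _ hk,
    ← Finset.sum_range_reflect (fun j => f j * r (k - j))]
  refine Finset.sum_congr rfl fun c hc => ?_
  have := Finset.mem_range.mp hc
  simp only [show k + 1 - 1 - c = k - c by omega, show k - (k - c) = c by omega]

lemma sum_lo_left {q : ℕ} (s : ℕ → Mq q) (f : ℕ → Mq q) {n i : ℕ} (hi : i ≤ n) :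
    ∑ j ∈ Finset.range (n + 1), lo s i j * f j =
      ∑ a ∈ Finset.range (i + 1), s (i - a) * f a := by
  rw [← sum_trunc _ hi]
  refine Finset.sum_congr rfl fun j _ => ?_
  by_cases h : j ≤ i <;> simp [lo, h]

lemma up_mul_up {q : ℕ} (s : ℕ → Mq q) (h0 : IsUnit (s 0).det) (n : ℕ) :
    blk (up s) n * blk (up (reciprocal q s)) n = 1 := by
  rw [blk_mul, ← blk_one]
  refine blk_congr fun j k hj hk => ?_
  rw [sum_up_right _ _ hk]
  by_cases h : j ≤ k
  · have h1 : ∀ c ∈ Finset.range (k + 1), up s j (k - c) * reciprocal q s c =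
        if c ≤ k - j then s (k - j - c) * reciprocal q s c else 0 := by
      intro c hc
      have := Finset.mem_range.mp hc
      by_cases h' : c ≤ k - j
      · rw [up, if_pos (by omega), if_pos h', show k - c - j = k - j - c by omega]
      · rw [up, if_neg (by omega), if_neg h', zero_mul]
    rw [Finset.sum_congr rfl h1, sum_trunc _ (by omega), conv_recip s h0]
    simp only [dgk]
    congr 1
    simp only [eq_iff_iff]; omega
  · rw [dgk, if_neg (by omega)]
    refine Finset.sum_eq_zero fun c hc => ?_
    rw [up, if_neg (by omega), zero_mul]

/-- First key identity. -/
lemma key1 {q : ℕ} (s : ℕ → Mq q) (h0 : IsUnit (s 0).det) (n : ℕ) :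
    blk (lo s) n * blk (fun i j => reciprocal q s (i + j + 1)) n =
      -(Kmat q s n * blk (up (reciprocal q s)) n) := by
  have hK : Kmat q s n = blk (fun i j => s (i + j + 1)) n := rfl
  rw [hK, blk_mul, blk_mul, blk_neg]
  refine blk_congr fun j k hj hk => ?_
  rw [sum_up_right _ _ hk, sum_lo_left _ _ hj]
  have h := conv_recip s h0 (j + k + 1)
  rw [if_neg (by omega), show j + k + 1 + 1 = (k + 1) + (j + 1) by omega,
    Finset.sum_range_add] at h
  rw [eq_neg_iff_add_eq_zero, add_comm, ← h]
  congr 1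
  · refine Finset.sum_congr rfl fun c hc => ?_
    have := Finset.mem_range.mp hc
    rw [show j + (k - c) + 1 = j + k + 1 - c by omega]
  · refine Finset.sum_congr rfl fun c hc => ?_
    have := Finset.mem_range.mp hc
    rw [show j + k + 1 - (k + 1 + c) = j - c by omega, show c + k + 1 = k + 1 + c by omega]

/-- Kernel of the block diagonal matrix in the second key identity. -/
def Gk {q : ℕ} (r : ℕ → Mq q) (i j : ℕ) : Mq q :=
  if i = 0 then (if j = 0 then r 0 else 0) else (if j = 0 then 0 else - r (i + j))

/-- Second key identity. -/
lemma key2 {q : ℕ} (s : ℕ → Mq q) (h0 : IsUnit (s 0).det) (n : ℕ) :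
    blk (lo s) n * blk (Gk (reciprocal q s)) n =
      Hmat q s n * blk (up (reciprocal q s)) n := by
  have hH : Hmat q s n = blk (fun i j => s (i + j)) n := rfl
  rw [hH, blk_mul, blk_mul]
  refine blk_congr fun j k hj hk => ?_
  rw [sum_up_right _ _ hk, sum_lo_left _ _ hj, Finset.sum_range_succ']
  by_cases hk0 : k = 0
  · subst hk0
    simp [Gk]
  · have h := conv_recip s h0 (j + k)
    rw [if_neg (by omega), show j + k + 1 = (k + 1) + j by omega,
      Finset.sum_range_add] at h
    have e1 : ∑ c ∈ Finset.range (k + 1), s (j + (k - c)) * reciprocal q s c =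
        ∑ c ∈ Finset.range (k + 1), s (j + k - c) * reciprocal q s c := by
      refine Finset.sum_congr rfl fun c hc => ?_
      have := Finset.mem_range.mp hc
      rw [show j + (k - c) = j + k - c by omega]
    rw [e1, ← sub_eq_zero, ← neg_eq_zero, ← h]
    have e2 : ∑ c ∈ Finset.range j, s (j - (c + 1)) * Gk (reciprocal q s) (c + 1) k =
        - ∑ x ∈ Finset.range j, s (j + k - (k + 1 + x)) * reciprocal q s (k + 1 + x) := by
      rw [← Finset.sum_neg_distrib]
      refine Finset.sum_congr rfl fun c hc => ?_
      have := Finset.mem_range.mp hc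
      rw [show j + k - (k + 1 + c) = j - (c + 1) by omega,
        show k + 1 + c = c + 1 + k by omega]
      simp [Gk, hk0]
    rw [e2]
    simp [Gk, hk0]

/-! ### Consequences of positivity -/

lemma spd_herm {q : ℕ} {s : ℕ → Mq q} (hs : IsStieltjesPD q s) (j : ℕ) : (s j)ᴴ = s j := by
  have h := (hs j).1.isHermitian
  ext a b
  have := congrFun (congrFun h (⟨j, by omega⟩, a)) (⟨0, by omega⟩, b)
  simpa [Hmat] using this

lemma spd_unit {q : ℕ} {s : ℕ → Mq q} (hs : IsStieltjesPD q s) : IsUnit (s 0).det := by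
  have h := (hs 0).1.submatrix (e := fun a : Fin q => ((0 : Fin 1), a))
    (fun a b hab => by simpa using hab)
  have e : (Hmat q s 0).submatrix (fun a : Fin q => ((0 : Fin 1), a))
    (fun a : Fin q => ((0 : Fin 1), a)) = s 0 := by
    ext a b; simp [Hmat]
  rw [e] at h
  exact (Matrix.isUnit_iff_isUnit_det _).mp h.isUnit

lemma lo_eq {q : ℕ} {s : ℕ → Mq q} (hs : IsStieltjesPD q s) (n : ℕ) :
    blk (lo s) n = (blk (up s) n)ᴴ := by
  rw [blk_conjTranspose]
  refine blk_congr fun i j _ _ => ?_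
  by_cases h : j ≤ i <;> simp [lo, up, h, spd_herm hs]

lemma inv_cong {ι : Type*} [Fintype ι] [DecidableEq ι] {D E U V K : Matrix ι ι ℂ}
    (hK : IsUnit K) (hUV : U * V = 1) (hDE : D * E = 1) :
    (D * (Vᴴ * K * V) * D)⁻¹ = E * (U * K⁻¹ * Uᴴ) * E := by
  have hVU : V * U = 1 := mul_eq_one_comm.mp hUV
  have hKK : K * K⁻¹ = 1 := Matrix.mul_nonsing_inv _ ((Matrix.isUnit_iff_isUnit_det _).mp hK)
  have hH : Vᴴ * Uᴴ = 1 := by rw [← Matrix.conjTranspose_mul, hUV, Matrix.conjTranspose_one]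
  apply Matrix.inv_eq_right_inv
  calc D * (Vᴴ * K * V) * D * (E * (U * K⁻¹ * Uᴴ) * E)
      = D * Vᴴ * K * V * (D * E) * U * K⁻¹ * Uᴴ * E := by simp only [mul_assoc]
    _ = D * Vᴴ * K * (V * U) * K⁻¹ * Uᴴ * E := by rw [hDE]; simp only [mul_assoc, mul_one, one_mul]
    _ = D * Vᴴ * (K * K⁻¹) * Uᴴ * E := by rw [hVU]; simp only [mul_assoc, mul_one, one_mul]
    _ = D * (Vᴴ * Uᴴ) * E := by rw [hKK]; simp only [mul_assoc, mul_one, one_mul]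
    _ = 1 := by rw [hH, mul_one, hDE]

lemma posDef_cong {ι : Type*} [Fintype ι] [DecidableEq ι] {D E U V K : Matrix ι ι ℂ}
    (hK : K.PosDef) (hUV : U * V = 1) (hDE : D * E = 1) (hD : Dᴴ = D) :
    (D * (Vᴴ * K * V) * D).PosDef := by
  have hVU : V * U = 1 := mul_eq_one_comm.mp hUV
  have hED : E * D = 1 := mul_eq_one_comm.mp hDE
  have hu : IsUnit (V * D) := by
    refine IsUnit.of_mul_eq_one (E * U) ?_
    calc V * D * (E * U) = V * (D * E) * U := by simp only [mul_assoc]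
      _ = 1 := by rw [hDE, mul_one, hVU]
  have := hK.conjTranspose_mul_mul_same (B := V * D) (Matrix.mulVec_injective_iff_isUnit.mpr hu)
  rw [Matrix.conjTranspose_mul, hD] at this
  simpa only [mul_assoc] using this

lemma DE {q : ℕ} {s : ℕ → Mq q} (hs : IsStieltjesPD q s) (n : ℕ) :
    blk (dgk (s 0)) n * blk (dgk (s 0)⁻¹) n = 1 := by
  rw [dg_mul_dg, Matrix.mul_nonsing_inv _ (spd_unit hs), blk_one]

lemma Hmat_katetov {q : ℕ} {s : ℕ → Mq q} (hs : IsStieltjesPD q s) (n : ℕ) :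
    Hmat q (katetov1 q s) n = blk (dgk (s 0)) n * ((blk (up (reciprocal q s)) n)ᴴ *
      Kmat q s n * blk (up (reciprocal q s)) n) * blk (dgk (s 0)) n := by
  have h := key1 s (spd_unit hs) n
  have hU := up_mul_up s (spd_unit hs) n
  have hU' : (blk (up (reciprocal q s)) n)ᴴ * (blk (up s) n)ᴴ = 1 := by
    rw [← Matrix.conjTranspose_mul, hU, Matrix.conjTranspose_one]
  rw [lo_eq hs] at h
  have h2 := congrArg (fun X => (blk (up (reciprocal q s)) n)ᴴ * X) h
  simp only [← mul_assoc, mul_neg, hU', one_mul] at h2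
  rw [← neg_eq_iff_eq_neg, blk_neg] at h2
  rw [← h2, dg_mul_blk, blk_mul_dg]
  change blk (fun i j => katetov1 q s (i + j)) n = _
  exact blk_congr fun i j _ _ => by simp [katetov1]

/-- Block diagonal matrix `diag(a, M)`. -/
def dgm {q n : ℕ} (a : Mq q) (M : Matrix (Fin (n + 1) × Fin q) (Fin (n + 1) × Fin q) ℂ) :
    Matrix (Fin (n + 2) × Fin q) (Fin (n + 2) × Fin q) ℂ :=
  Matrix.of fun p r => Fin.cases (motive := fun _ => ℂ)
    (Fin.cases (motive := fun _ => ℂ) (a p.2 r.2) (fun _ => 0) r.1)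
    (fun i => Fin.cases (motive := fun _ => ℂ) 0 (fun j => M (i, p.2) (j, r.2)) r.1) p.1

/-- Block column `col(a, C)`. -/
def dcm {q n : ℕ} (a : Mq q) (M : Matrix (Fin (n + 1) × Fin q) (Fin q) ℂ) :
    Matrix (Fin (n + 2) × Fin q) (Fin q) ℂ :=
  Matrix.of fun p b => Fin.cases (motive := fun _ => ℂ) (a p.2 b) (fun i => M (i, p.2) b) p.1

lemma dgm_mul {q n : ℕ} (a b : Mq q)
    (M N : Matrix (Fin (n + 1) × Fin q) (Fin (n + 1) × Fin q) ℂ) :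
    dgm a M * dgm b N = dgm (a * b) (M * N) := by
  ext ⟨i, x⟩ ⟨j, y⟩
  refine Fin.cases ?_ (fun i => ?_) i <;> refine Fin.cases ?_ (fun j => ?_) j <;>
    simp [dgm, Matrix.mul_apply, Fintype.sum_prod_type, Fin.sum_univ_succ (n := n + 1)]

lemma dgm_one {q n : ℕ} : dgm (1 : Mq q) (1 : Matrix (Fin (n + 1) × Fin q) _ ℂ) = 1 := by
  ext ⟨i, x⟩ ⟨j, y⟩
  refine Fin.cases ?_ (fun i => ?_) i <;> refine Fin.cases ?_ (fun j => ?_) j <;>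
    simp [dgm, Matrix.one_apply, Fin.succ_ne_zero, (Fin.succ_ne_zero _).symm]

lemma dgm_mul_dcm {q n : ℕ} (a b : Mq q)
    (M : Matrix (Fin (n + 1) × Fin q) (Fin (n + 1) × Fin q) ℂ)
    (N : Matrix (Fin (n + 1) × Fin q) (Fin q) ℂ) :
    dgm a M * dcm b N = dcm (a * b) (M * N) := by
  ext ⟨i, x⟩ y
  refine Fin.cases ?_ (fun i => ?_) i <;>
    simp [dgm, dcm, Matrix.mul_apply, Fintype.sum_prod_type, Fin.sum_univ_succ (n := n + 1)]

lemma dcm_mul_dcm {q n : ℕ} (a b : Mq q)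
    (M N : Matrix (Fin (n + 1) × Fin q) (Fin q) ℂ) :
    (dcm a M)ᴴ * dcm b N = aᴴ * b + Mᴴ * N := by
  ext x y
  simp [dcm, Matrix.mul_apply, Fintype.sum_prod_type, Fin.sum_univ_succ (n := n + 1)]

lemma dgm_katetov {q : ℕ} {s : ℕ → Mq q} (hs : IsStieltjesPD q s) (n : ℕ) :
    dgm (s 0) (Kmat q (katetov1 q s) n) =
      blk (dgk (s 0)) (n + 1) * ((blk (up (reciprocal q s)) (n + 1))ᴴ *
      Hmat q s (n + 1) * blk (up (reciprocal q s)) (n + 1)) * blk (dgk (s 0)) (n + 1) := by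
  have h := key2 s (spd_unit hs) (n + 1)
  have hU := up_mul_up s (spd_unit hs) (n + 1)
  have hU' : (blk (up (reciprocal q s)) (n + 1))ᴴ * (blk (up s) (n + 1))ᴴ = 1 := by
    rw [← Matrix.conjTranspose_mul, hU, Matrix.conjTranspose_one]
  rw [lo_eq hs] at h
  have h2 := congrArg (fun X => (blk (up (reciprocal q s)) (n + 1))ᴴ * X) h
  simp only [← mul_assoc, hU', one_mul] at h2
  rw [← h2, dg_mul_blk, blk_mul_dg]
  have e0 : s 0 * (s 0)⁻¹ * s 0 = s 0 := by
    rw [Matrix.mul_nonsing_inv _ (spd_unit hs), one_mul]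
  ext ⟨i, x⟩ ⟨j, y⟩
  refine Fin.cases ?_ (fun i => ?_) i <;> refine Fin.cases ?_ (fun j => ?_) j
  · simp [dgm, blk, Gk, reciprocal, e0]
  · simp [dgm, blk, Gk]
  · simp [dgm, blk, Gk]
  · simp [dgm, blk, Gk, Kmat, katetov1, show i.1 + 1 + (j.1 + 1) = i.1 + j.1 + 1 + 1 by omega]

lemma spd_katetov1 {q : ℕ} {s : ℕ → Mq q} (hs : IsStieltjesPD q s) :
    IsStieltjesPD q (katetov1 q s) := by
  intro n
  have hD : ∀ n, (blk (dgk (s 0)) n)ᴴ = blk (dgk (s 0)) n := fun n => by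
    rw [dg_conjTranspose, spd_herm hs]
  constructor
  · rw [Hmat_katetov hs]
    exact posDef_cong (hs n).2 (up_mul_up s (spd_unit hs) n) (DE hs n) (hD n)
  · have h := posDef_cong (hs (n + 1)).1 (up_mul_up s (spd_unit hs) (n + 1)) (DE hs (n + 1))
      (hD (n + 1))
    rw [← dgm_katetov hs] at h
    have := h.submatrix (e := fun p : Fin (n + 1) × Fin q => (p.1.succ, p.2))
      (fun a b hab => by
        simp only [Prod.mk.injEq, Fin.succ_inj] at hab
        exact Prod.ext hab.1 hab.2)
    exact this

lemma vcol_eq {q n : ℕ} : vcol q n = bc (fun i => if i = 0 then 1 else 0) n := by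
  ext ⟨i, a⟩ b
  simp only [vcol, bc, Matrix.of_apply]
  by_cases h : i.1 = 0
  · simp only [h, true_and, if_true, Matrix.one_apply]
  · simp only [h, false_and, if_false, Matrix.zero_apply]

lemma isUnit_inv_cancel {ι : Type*} [Fintype ι] [DecidableEq ι] {K : Matrix ι ι ℂ}
    (hK : K.PosDef) : K * K⁻¹ = 1 :=
  Matrix.mul_nonsing_inv _ ((Matrix.isUnit_iff_isUnit_det _).mp hK.isUnit)

/-- The quadratic form defining `𝔐`. -/
def qM (q : ℕ) (s : ℕ → Mq q) (n : ℕ) : Mq q := (vcol q n)ᴴ * (Hmat q s n)⁻¹ * vcol q n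

/-- The quadratic form defining `𝔏`. -/
def qL (q : ℕ) (s : ℕ → Mq q) (n : ℕ) : Mq q := (ycol q s n)ᴴ * (Kmat q s n)⁻¹ * ycol q s n

lemma inv_herm {q : ℕ} {s : ℕ → Mq q} (hs : IsStieltjesPD q s) : ((s 0)⁻¹)ᴴ = (s 0)⁻¹ := by
  rw [Matrix.conjTranspose_nonsing_inv, spd_herm hs]

lemma qM_katetov {q : ℕ} {s : ℕ → Mq q} (hs : IsStieltjesPD q s) (n : ℕ) :
    qM q (katetov1 q s) n = (s 0)⁻¹ * qL q s n * (s 0)⁻¹ := by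
  have hE : (blk (dgk (s 0)⁻¹) n)ᴴ = blk (dgk (s 0)⁻¹) n := by
    rw [dg_conjTranspose, inv_herm hs]
  have h1 : (blk (up s) n)ᴴ * blk (dgk (s 0)⁻¹) n * vcol q n = ycol q s n * (s 0)⁻¹ := by
    rw [← lo_eq hs, Matrix.mul_assoc, vcol_eq, dg_mul_bc, blk_mul_bc]
    have : ycol q s n * (s 0)⁻¹ = bc (fun i => s i * (s 0)⁻¹) n := by
      ext ⟨i, a⟩ b
      simp [ycol, bc, Matrix.mul_apply]
    rw [this]
    refine bc_congr fun i hi => ?_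
    rw [Finset.sum_eq_single 0]
    · simp [lo]
    · intro b _ hb; simp [hb]
    · simp
  have h2 := congrArg Matrix.conjTranspose h1
  simp only [Matrix.conjTranspose_mul, Matrix.conjTranspose_conjTranspose, hE, inv_herm hs] at h2
  rw [qM, Hmat_katetov hs,
    inv_cong (hs n).2.isUnit (up_mul_up s (spd_unit hs) n) (DE hs n), qL]
  calc _ = ((vcol q n)ᴴ * (blk (dgk (s 0)⁻¹) n * blk (up s) n)) * (Kmat q s n)⁻¹ *
        ((blk (up s) n)ᴴ * blk (dgk (s 0)⁻¹) n * vcol q n) := by simp only [Matrix.mul_assoc]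
    _ = _ := by rw [h1, h2]; simp only [Matrix.mul_assoc]

lemma recip_succ {q : ℕ} {s : ℕ → Mq q} (hs : IsStieltjesPD q s) (j : ℕ) :
    reciprocal q s (j + 1) * s 0 = -((s 0)⁻¹ * katetov1 q s j) := by
  rw [katetov1]
  simp only [neg_mul, mul_neg, neg_neg, ← mul_assoc, Matrix.nonsing_inv_mul _ (spd_unit hs),
    one_mul]

lemma qL_katetov {q : ℕ} {s : ℕ → Mq q} (hs : IsStieltjesPD q s) (n : ℕ) :
    qM q s (n + 1) = (s 0)⁻¹ + (s 0)⁻¹ * qL q (katetov1 q s) n * (s 0)⁻¹ := by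
  have ht := spd_katetov1 hs
  have hD : (blk (dgk (s 0)) (n + 1))ᴴ = blk (dgk (s 0)) (n + 1) := by
    rw [dg_conjTranspose, spd_herm hs]
  have hH := dgm_katetov hs n
  set D := blk (dgk (s 0)) (n + 1) with hDdef
  set V := blk (up (reciprocal q s)) (n + 1) with hVdef
  set U := blk (up s) (n + 1) with hUdef
  have hUV : U * V = 1 := up_mul_up s (spd_unit hs) (n + 1)
  have hVU : V * U = 1 := mul_eq_one_comm.mp hUV
  have hDE : D * blk (dgk (s 0)⁻¹) (n + 1) = 1 := DE hs (n + 1)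
  have hinv := inv_cong (hs (n + 1)).1.isUnit hUV hDE
  set E := blk (dgk (s 0)⁻¹) (n + 1) with hEdef
  have hED : E * D = 1 := mul_eq_one_comm.mp hDE
  have hHV : Uᴴ * Vᴴ = 1 := by rw [← Matrix.conjTranspose_mul, hVU, Matrix.conjTranspose_one]
  rw [← hH] at hinv
  have hdg : (dgm (s 0) (Kmat q (katetov1 q s) n))⁻¹ =
      dgm (s 0)⁻¹ (Kmat q (katetov1 q s) n)⁻¹ := by
    apply Matrix.inv_eq_right_inv
    rw [dgm_mul, Matrix.mul_nonsing_inv _ (spd_unit hs), isUnit_inv_cancel (ht n).2, dgm_one]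
  have hHinv : (Hmat q s (n + 1))⁻¹ =
      V * D * dgm (s 0)⁻¹ (Kmat q (katetov1 q s) n)⁻¹ * (D * Vᴴ) := by
    rw [← hdg, hinv]
    symm
    calc _ = V * (D * E) * U * (Hmat q s (n + 1))⁻¹ * Uᴴ * (E * D) * Vᴴ := by
          simp only [mul_assoc]
      _ = (V * U) * (Hmat q s (n + 1))⁻¹ * (Uᴴ * Vᴴ) := by
          rw [hDE, hED]; simp only [mul_assoc, mul_one, one_mul]
      _ = _ := by rw [hVU, hHV, one_mul, mul_one]
  have hw : (vcol q (n + 1))ᴴ * V * D =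
      (dcm 1 (-(ycol q (katetov1 q s) n * (s 0)⁻¹)))ᴴ := by
    rw [vcol_eq, bc_conjTranspose, br_mul_blk, br_mul_dg]
    have e : ∀ i, i ≤ n + 1 → (∑ j ∈ Finset.range (n + 1 + 1),
        (if j = 0 then (1 : Mq q) else 0)ᴴ * up (reciprocal q s) j i) = reciprocal q s i := by
      intro i _
      rw [Finset.sum_eq_single 0]
      · simp [up]
      · intro b _ hb; simp [hb]
      · simp
    ext a ⟨i, b⟩
    simp only [br, Matrix.of_apply]
    rw [e _ (by omega)]
    refine Fin.cases ?_ (fun i => ?_) i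
    · simp only [Fin.val_zero, reciprocal, Matrix.nonsing_inv_mul _ (spd_unit hs)]
      simp [dcm, Matrix.one_apply, eq_comm, apply_ite]
    · simp only [Fin.val_succ, recip_succ hs]
      have : -((s 0)⁻¹ * katetov1 q s i.1) = (-(katetov1 q s i.1 * (s 0)⁻¹))ᴴ := by
        rw [Matrix.conjTranspose_neg, Matrix.conjTranspose_mul, inv_herm hs, spd_herm ht]
      rw [this]
      simp [dcm, ycol, Matrix.mul_apply]
  have hw2 := congrArg Matrix.conjTranspose hw
  simp only [Matrix.conjTranspose_mul, Matrix.conjTranspose_conjTranspose, hD] at hw2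
  rw [qM, hHinv]
  calc _ = ((vcol q (n + 1))ᴴ * V * D) * (dgm (s 0)⁻¹ (Kmat q (katetov1 q s) n)⁻¹ *
        (D * (Vᴴ * vcol q (n + 1)))) := by simp only [Matrix.mul_assoc]
    _ = _ := by
      rw [hw, hw2, dgm_mul_dcm, dcm_mul_dcm, qL]
      simp only [Matrix.conjTranspose_neg, Matrix.conjTranspose_mul, inv_herm hs, neg_mul,
        Matrix.neg_mul, Matrix.mul_neg, neg_neg, Matrix.mul_assoc, Matrix.conjTranspose_one,
        Matrix.one_mul, Matrix.mul_one]

/-! ### The values `P_n(0)` and `Q̂_n(0)` -/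

/-- `C` is the monic solution of the orthogonality relations with respect to `s`. -/
def IsCol {q : ℕ} (s : ℕ → Mq q) (n : ℕ) (C : ℕ → Mq q) : Prop :=
  C n = 1 ∧ ∀ i, i < n → ∑ j ∈ Finset.range (n + 1), s (i + j) * C j = 0

/-- Shifted sequence. -/
def shiftSeq {q : ℕ} (s : ℕ → Mq q) : ℕ → Mq q := fun j => s (j + 1)

lemma bc_surj {q n : ℕ} (X : Matrix (Fin (n + 1) × Fin q) (Fin q) ℂ) : ∃ C, bc C n = X := by
  refine ⟨fun i => Matrix.of fun a b => if h : i < n + 1 then X (⟨i, h⟩, a) b else 0, ?_⟩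
  ext ⟨i, a⟩ b
  simp only [bc, Matrix.of_apply, dif_pos i.2]

lemma ycolGen {q n : ℕ} (s : ℕ → Mq q) :
    (Matrix.of fun (r : Fin (n + 1) × Fin q) (c : Fin q) => s (n + 1 + r.1.1) r.2 c) =
      bc (fun i => s (n + 1 + i)) n := rfl

lemma isCol_succ_iff {q n : ℕ} {s : ℕ → Mq q} (hH : IsUnit (Hmat q s n)) (C : ℕ → Mq q) :
    IsCol s (n + 1) C ↔ C (n + 1) = 1 ∧
      bc C n = -((Hmat q s n)⁻¹ * bc (fun i => s (n + 1 + i)) n) := by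
  have hd := (Matrix.isUnit_iff_isUnit_det _).mp hH
  have hHb : Hmat q s n = blk (fun i j => s (i + j)) n := rfl
  unfold IsCol
  refine and_congr_right fun h1 => ?_
  have hneg : bc (fun i => -s (n + 1 + i)) n = -bc (fun i => s (n + 1 + i)) n := by
    ext ⟨i, a⟩ b; simp [bc]
  constructor
  · intro h
    have : Hmat q s n * bc C n = -bc (fun i => s (n + 1 + i)) n := by
      rw [hHb, blk_mul_bc, ← hneg]
      refine bc_congr fun i hi => ?_
      have := h i (by omega)
      rw [Finset.sum_range_succ, h1, mul_one] at this
      rw [eq_neg_of_add_eq_zero_left this, show i + (n + 1) = n + 1 + i by omega]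
    rw [← Matrix.mul_neg, ← this, Matrix.nonsing_inv_mul_cancel_left _ _ hd]
  · intro h i hi
    have h2 : Hmat q s n * bc C n = bc (fun i => -s (n + 1 + i)) n := by
      rw [h, Matrix.mul_neg, Matrix.mul_nonsing_inv_cancel_left _ _ hd, hneg]
    rw [hHb, blk_mul_bc] at h2
    have := bc_inj h2 i (by omega)
    rw [Finset.sum_range_succ, h1, mul_one, this, show i + (n + 1) = n + 1 + i by omega]
    simp

lemma exists_isCol {q : ℕ} {s : ℕ → Mq q} (hH : ∀ n, IsUnit (Hmat q s n)) (n : ℕ) :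
    ∃ C, IsCol s n C := by
  cases n with
  | zero => exact ⟨fun _ => 1, rfl, fun i hi => absurd hi (by omega)⟩
  | succ n =>
    obtain ⟨C, hC⟩ := bc_surj (-((Hmat q s n)⁻¹ * bc (fun i => s (n + 1 + i)) n))
    refine ⟨fun i => if i ≤ n then C i else 1, (isCol_succ_iff (hH n) _).mpr ⟨?_, ?_⟩⟩
    · simp
    · rw [← hC]
      exact bc_congr fun i hi => by simp [hi]

lemma colH_eq {q n : ℕ} {s : ℕ → Mq q} (hH : IsUnit (Hmat q s n)) {C : ℕ → Mq q}
    (hC : IsCol s (n + 1) C) : colH q s n = bc C (n + 1) := by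
  obtain ⟨h1, h2⟩ := (isCol_succ_iff hH C).mp hC
  ext ⟨i, a⟩ b
  simp only [colH, Matrix.of_apply, ycolGen, ← h2]
  by_cases h : i.1 < n + 1
  · simp [h, bc]
  · have hi : i.1 = n + 1 := by omega
    simp [bc, hi, h1, Matrix.one_apply]

lemma Rmat_zero {q n : ℕ} : (Rmat q n (starRingEnd ℂ 0))ᴴ = 1 := by
  simp [Rmat]

lemma Ppoly_eq {q n : ℕ} {s : ℕ → Mq q} (hs : IsStieltjesPD q s) {C : ℕ → Mq q}
    (hC : IsCol s n C) : Ppoly q s n 0 = C 0 := by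
  cases n with
  | zero => exact hC.1.symm
  | succ n =>
    rw [Ppoly, Rmat_zero, Matrix.mul_one, colH_eq (hs n).1.isUnit hC, vcol_eq, bc_conjTranspose,
      br_mul_bc, Finset.sum_eq_single 0]
    · simp
    · intro b _ hb; simp [hb]
    · simp

lemma colK_eq {q n : ℕ} (s : ℕ → Mq q) : colK q s n = colH q (shiftSeq s) n := by
  unfold colK colH
  have : (Matrix.of fun (r : Fin (n + 1) × Fin q) (c : Fin q) => s (n + 2 + r.1.1) r.2 c) =
      Matrix.of fun (r : Fin (n + 1) × Fin q) (c : Fin q) =>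
        shiftSeq s (n + 1 + r.1.1) r.2 c := by
    ext r c
    simp only [Matrix.of_apply, shiftSeq]
    rw [show n + 2 + r.1.1 = n + 1 + r.1.1 + 1 by omega]
  rw [this]
  rfl

lemma Qhat_eq {q n : ℕ} {s : ℕ → Mq q} (hs : IsStieltjesPD q s) {C : ℕ → Mq q}
    (hC : IsCol (shiftSeq s) n C) :
    Qhat q s n 0 = ∑ j ∈ Finset.range (n + 1), s j * C j := by
  cases n with
  | zero => simp [Qhat, hC.1]
  | succ n =>
    have hu : IsUnit (Hmat q (shiftSeq s) n) := (hs n).2.isUnit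
    rw [Qhat, Rmat_zero, Matrix.mul_one, colK_eq, colH_eq hu hC]
    exact br_mul_bc _ _ _

lemma step1 {q n : ℕ} {s : ℕ → Mq q} (hs : IsStieltjesPD q s) {Y : ℕ → Mq q}
    (hY : IsCol (shiftSeq s) n Y) : ∃ X, IsCol (katetov1 q s) n X ∧
      X 0 = (s 0)⁻¹ * ∑ j ∈ Finset.range (n + 1), s j * Y j := by
  have hE := mul_eq_one_comm.mp (DE hs n)
  have hDE := DE hs n
  have hUV := up_mul_up s (spd_unit hs) n
  have hVU := mul_eq_one_comm.mp hUV
  have hinv0 := Matrix.nonsing_inv_mul _ (spd_unit hs)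
  refine ⟨fun i => (s 0)⁻¹ * ∑ j ∈ Finset.range (n + 1), up s i j * Y j, ⟨?_, ?_⟩, ?_⟩
  · beta_reduce
    rw [Finset.sum_eq_single n]
    · simp [up, hY.1, hinv0]
    · intro b hb hbn
      have := Finset.mem_range.mp hb
      rw [up, if_neg (by omega), zero_mul]
    · simp
  · intro i hi
    have hKb : Kmat q s n = blk (fun i j => s (i + j + 1)) n := rfl
    have key : Hmat q (katetov1 q s) n * (blk (dgk (s 0)⁻¹) n * (blk (up s) n * bc Y n)) =
        blk (dgk (s 0)) n * ((blk (up (reciprocal q s)) n)ᴴ * (Kmat q s n * bc Y n)) := by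
      rw [Hmat_katetov hs]
      calc _ = blk (dgk (s 0)) n * ((blk (up (reciprocal q s)) n)ᴴ * (Kmat q s n *
            ((blk (up (reciprocal q s)) n * ((blk (dgk (s 0)) n * blk (dgk (s 0)⁻¹) n) *
              blk (up s) n)) * bc Y n))) := by
            simp only [Matrix.mul_assoc]
        _ = _ := by rw [hDE, Matrix.one_mul, hVU, Matrix.one_mul]
    have hHb : Hmat q (katetov1 q s) n = blk (fun i j => katetov1 q s (i + j)) n := rfl
    rw [hHb, hKb, blk_mul_bc, dg_mul_bc, blk_mul_bc, blk_mul_bc, blk_conjTranspose, blk_mul_bc,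
      dg_mul_bc] at key
    have := bc_inj key i (by omega)
    rw [this]
    have hz : ∑ j ∈ Finset.range (n + 1), (up (reciprocal q s) j i)ᴴ *
        ∑ l ∈ Finset.range (n + 1), s (j + l + 1) * Y l = 0 := by
      refine Finset.sum_eq_zero fun j hj => ?_
      have hj' := Finset.mem_range.mp hj
      by_cases hjn : j < n
      · have := hY.2 j hjn
        simp only [shiftSeq] at this
        rw [this, mul_zero]
      · rw [up, if_neg (by omega), Matrix.conjTranspose_zero, zero_mul]
    rw [hz, mul_zero]
  · simp [up]

lemma dcm_zero_bc {q n : ℕ} (W : ℕ → Mq q) :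
    dcm 0 (bc W n) = bc (fun i => if i = 0 then 0 else W (i - 1)) (n + 1) := by
  ext ⟨i, a⟩ b
  refine Fin.cases ?_ (fun i => ?_) i <;> simp [dcm, bc]

lemma step2 {q n : ℕ} {s : ℕ → Mq q} (hs : IsStieltjesPD q s) {W : ℕ → Mq q}
    (hW : IsCol (shiftSeq (katetov1 q s)) n W) : ∃ X, IsCol s (n + 1) X ∧
      X 0 = -((s 0)⁻¹ * ∑ j ∈ Finset.range (n + 1), katetov1 q s j * W j) := by
  have hDE := DE hs (n + 1)
  have hED := mul_eq_one_comm.mp hDE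
  have hUV := up_mul_up s (spd_unit hs) (n + 1)
  have hVU := mul_eq_one_comm.mp hUV
  have hHV : (blk (up s) (n + 1))ᴴ * (blk (up (reciprocal q s)) (n + 1))ᴴ = 1 := by
    rw [← Matrix.conjTranspose_mul, hVU, Matrix.conjTranspose_one]
  have hinv0 := Matrix.nonsing_inv_mul _ (spd_unit hs)
  refine ⟨fun i => ∑ j ∈ Finset.range (n + 1 + 1), up (reciprocal q s) i j *
    (s 0 * (if j = 0 then 0 else W (j - 1))), ⟨?_, ?_⟩, ?_⟩
  · beta_reduce
    rw [Finset.sum_eq_single (n + 1)]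
    · simp [up, hW.1, reciprocal, hinv0]
    · intro b hb hbn
      have := Finset.mem_range.mp hb
      rw [up, if_neg (by omega), zero_mul]
    · simp
  · intro i hi
    have hKb : Kmat q (katetov1 q s) n = blk (fun i j => katetov1 q s (i + j + 1)) n := rfl
    have hHb : Hmat q s (n + 1) = blk (fun i j => s (i + j)) (n + 1) := rfl
    have key : Hmat q s (n + 1) * (blk (up (reciprocal q s)) (n + 1) *
        (blk (dgk (s 0)) (n + 1) * dcm 0 (bc W n))) =
        blk (lo s) (n + 1) * (blk (dgk (s 0)⁻¹) (n + 1) *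
          (dgm (s 0) (Kmat q (katetov1 q s) n) * dcm 0 (bc W n))) := by
      rw [dgm_katetov hs, lo_eq hs]
      symm
      calc _ = ((blk (up s) (n + 1))ᴴ * ((blk (dgk (s 0)⁻¹) (n + 1) * blk (dgk (s 0)) (n + 1)) *
            (blk (up (reciprocal q s)) (n + 1))ᴴ)) * (Hmat q s (n + 1) *
            (blk (up (reciprocal q s)) (n + 1) *
              (blk (dgk (s 0)) (n + 1) * dcm 0 (bc W n)))) := by
            simp only [Matrix.mul_assoc]
        _ = _ := by rw [hED, Matrix.one_mul, hHV, Matrix.one_mul]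
    rw [dgm_mul_dcm, mul_zero, hKb, hHb, blk_mul_bc, dcm_zero_bc, dcm_zero_bc, dg_mul_bc,
      dg_mul_bc, blk_mul_bc, blk_mul_bc, blk_mul_bc] at key
    have := bc_inj key i (by omega)
    rw [this]
    refine Finset.sum_eq_zero fun j hj => ?_
    have hj' := Finset.mem_range.mp hj
    by_cases hji : j ≤ i
    · by_cases hj0 : j = 0
      · simp [hj0]
      · have := hW.2 (j - 1) (by omega)
        simp only [shiftSeq] at this
        rw [if_neg hj0, this, mul_zero, mul_zero]
    · rw [lo, if_neg hji, zero_mul]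
  · beta_reduce
    rw [Finset.sum_range_succ', Finset.mul_sum, ← Finset.sum_neg_distrib]
    simp only [if_true, mul_zero, add_zero]
    refine Finset.sum_congr rfl fun j _ => ?_
    rw [if_neg (by omega), ← mul_assoc, up, if_pos (by omega), Nat.sub_zero, recip_succ hs]
    simp [mul_assoc]

lemma Qhat_rec {q : ℕ} {s : ℕ → Mq q} (hs : IsStieltjesPD q s) (n : ℕ) :
    Qhat q s n 0 = s 0 * Ppoly q (katetov1 q s) n 0 := by
  obtain ⟨Y, hY⟩ := exists_isCol (s := shiftSeq s) (fun n => (hs n).2.isUnit) n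
  obtain ⟨X, hX, hX0⟩ := step1 hs hY
  rw [Qhat_eq hs hY, Ppoly_eq (spd_katetov1 hs) hX, hX0, ← mul_assoc,
    Matrix.mul_nonsing_inv _ (spd_unit hs), one_mul]

lemma Ppoly_rec {q : ℕ} {s : ℕ → Mq q} (hs : IsStieltjesPD q s) (n : ℕ) :
    Ppoly q s (n + 1) 0 = -((s 0)⁻¹ * Qhat q (katetov1 q s) n 0) := by
  have ht := spd_katetov1 hs
  obtain ⟨Y, hY⟩ := exists_isCol (s := shiftSeq (katetov1 q s)) (fun n => (ht n).2.isUnit) n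
  obtain ⟨X, hX, hX0⟩ := step2 hs hY
  rw [Qhat_eq ht hY, Ppoly_eq hs hX, hX0]

/-! ### Recursions for the Dyukarev–Stieltjes parameters -/

lemma col_zero_form {q : ℕ} (M : Matrix (Fin 1 × Fin q) (Fin 1 × Fin q) ℂ) (A : Mq q)
    (hM : M = blk (dgk A) 0) (hA : IsUnit A) (B C : ℕ → Mq q) :
    (bc B 0)ᴴ * M⁻¹ * bc C 0 = (B 0)ᴴ * A⁻¹ * C 0 := by
  have hd := (Matrix.isUnit_iff_isUnit_det _).mp hA
  have : M⁻¹ = blk (dgk A⁻¹) 0 := by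
    apply Matrix.inv_eq_right_inv
    rw [hM, dg_mul_dg, Matrix.mul_nonsing_inv _ hd, blk_one]
  rw [this, bc_conjTranspose, br_mul_dg, br_mul_bc]
  simp

lemma spd_unit1 {q : ℕ} {s : ℕ → Mq q} (hs : IsStieltjesPD q s) : IsUnit (s 1) := by
  have h := (hs 0).2.submatrix (e := fun a : Fin q => ((0 : Fin 1), a))
    (fun a b hab => by simpa using hab)
  have e : (Kmat q s 0).submatrix (fun a : Fin q => ((0 : Fin 1), a))
    (fun a : Fin q => ((0 : Fin 1), a)) = s 1 := by
    ext a b; simp [Kmat]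
  rw [e] at h
  exact h.isUnit

lemma qM_zero {q : ℕ} {s : ℕ → Mq q} (hs : IsStieltjesPD q s) : qM q s 0 = (s 0)⁻¹ := by
  rw [qM, vcol_eq, col_zero_form _ (s 0) ?_ ((Matrix.isUnit_iff_isUnit_det _).mpr (spd_unit hs))]
  · simp
  · change blk (fun i j => s (i + j)) 0 = _
    refine blk_congr fun i j hi hj => ?_
    obtain rfl : i = 0 := by omega
    obtain rfl : j = 0 := by omega
    simp [dgk]

lemma qL_zero {q : ℕ} {s : ℕ → Mq q} (hs : IsStieltjesPD q s) :
    qL q s 0 = s 0 * (s 1)⁻¹ * s 0 := by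
  have hy : ycol q s 0 = bc s 0 := rfl
  rw [qL, hy, col_zero_form _ (s 1) ?_ (spd_unit1 hs), spd_herm hs]
  · change blk (fun i j => s (i + j + 1)) 0 = _
    refine blk_congr fun i j hi hj => ?_
    obtain rfl : i = 0 := by omega
    obtain rfl : j = 0 := by omega
    simp [dgk]

lemma DSM_katetov {q : ℕ} {s : ℕ → Mq q} (hs : IsStieltjesPD q s) (k : ℕ) :
    DSM q (katetov1 q s) k = (s 0)⁻¹ * DSL q s k * (s 0)⁻¹ := by
  cases k with
  | zero =>
    change (katetov1 q s 0)⁻¹ = (s 0)⁻¹ * (s 0 * (s 1)⁻¹ * s 0) * (s 0)⁻¹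
    rw [← qM_zero (spd_katetov1 hs), ← qL_zero hs, qM_katetov hs]
  | succ k =>
    change qM q (katetov1 q s) (k + 1) - qM q (katetov1 q s) k =
      (s 0)⁻¹ * (qL q s (k + 1) - qL q s k) * (s 0)⁻¹
    rw [qM_katetov hs, qM_katetov hs, mul_sub, sub_mul]

lemma DSM_succ {q : ℕ} {s : ℕ → Mq q} (hs : IsStieltjesPD q s) (k : ℕ) :
    DSM q s (k + 1) = (s 0)⁻¹ * DSL q (katetov1 q s) k * (s 0)⁻¹ := by
  cases k with
  | zero =>
    change qM q s 1 - qM q s 0 = (s 0)⁻¹ * (katetov1 q s 0 * (katetov1 q s 1)⁻¹ *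
      katetov1 q s 0) * (s 0)⁻¹
    rw [← qL_zero (spd_katetov1 hs), qM_zero hs, qL_katetov hs, add_sub_cancel_left]
  | succ k =>
    change qM q s (k + 2) - qM q s (k + 1) =
      (s 0)⁻¹ * (qL q (katetov1 q s) (k + 1) - qL q (katetov1 q s) k) * (s 0)⁻¹
    rw [qL_katetov hs, qL_katetov hs, mul_sub, sub_mul]
    abel

lemma DSL_eq {q : ℕ} {s : ℕ → Mq q} (hs : IsStieltjesPD q s) (k : ℕ) :
    DSL q s k = s 0 * DSM q (katetov1 q s) k * s 0 := by
  have h1 := Matrix.mul_nonsing_inv _ (spd_unit hs)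
  have h2 := Matrix.nonsing_inv_mul _ (spd_unit hs)
  rw [DSM_katetov hs]
  calc _ = (s 0 * (s 0)⁻¹) * DSL q s k * ((s 0)⁻¹ * s 0) := by rw [h1, h2, one_mul, mul_one]
    _ = _ := by simp only [mul_assoc]

lemma katetov_succ {q : ℕ} (s : ℕ → Mq q) (l : ℕ) :
    katetov q (l + 1) s = katetov q l (katetov1 q s) := by
  simp [katetov]

/-- Odd step. -/
lemma odd_of_even {q m : ℕ}
    (ih : ∀ s : ℕ → Mq q, IsStieltjesPD q s → IsUnit (Ppoly q s m 0).det ∧ ∀ j,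
      DSL q s (j + m) = ((Ppoly q s m 0)⁻¹)ᴴ * DSL q (katetov q (2 * m) s) j *
        (Ppoly q s m 0)⁻¹ ∧
      DSM q s (j + m) = Ppoly q s m 0 * DSM q (katetov q (2 * m) s) j * (Ppoly q s m 0)ᴴ)
    (s : ℕ → Mq q) (hs : IsStieltjesPD q s) : IsUnit (Qhat q s m 0).det ∧ ∀ j,
      DSL q s (j + m) = Qhat q s m 0 * DSM q (katetov q (2 * m + 1) s) j * (Qhat q s m 0)ᴴ ∧
      DSM q s (j + m + 1) = ((Qhat q s m 0)⁻¹)ᴴ * DSL q (katetov q (2 * m + 1) s) j *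
        (Qhat q s m 0)⁻¹ := by
  obtain ⟨hu, h⟩ := ih _ (spd_katetov1 hs)
  refine ⟨?_, fun j => ⟨?_, ?_⟩⟩
  · rw [Qhat_rec hs, Matrix.det_mul]
    exact (spd_unit hs).mul hu
  · rw [DSL_eq hs, (h j).2, katetov_succ, Qhat_rec hs, Matrix.conjTranspose_mul, spd_herm hs]
    simp only [mul_assoc]
  · rw [DSM_succ hs, (h j).1, katetov_succ, Qhat_rec hs, Matrix.mul_inv_rev,
      Matrix.conjTranspose_mul, inv_herm hs]
    simp only [mul_assoc]

/-- Even relations. -/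
lemma even_rel {q : ℕ} (m : ℕ) :
    ∀ s : ℕ → Mq q, IsStieltjesPD q s → IsUnit (Ppoly q s m 0).det ∧ ∀ j,
      DSL q s (j + m) = ((Ppoly q s m 0)⁻¹)ᴴ * DSL q (katetov q (2 * m) s) j *
        (Ppoly q s m 0)⁻¹ ∧
      DSM q s (j + m) = Ppoly q s m 0 * DSM q (katetov q (2 * m) s) j * (Ppoly q s m 0)ᴴ := by
  induction m with
  | zero =>
    intro s hs
    simp [Ppoly, katetov]
  | succ m ih =>
    intro s hs
    obtain ⟨hu, h⟩ := odd_of_even ih _ (spd_katetov1 hs)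
    have hk : katetov q (2 * (m + 1)) s = katetov q (2 * m + 1) (katetov1 q s) := by
      rw [show 2 * (m + 1) = 2 * m + 1 + 1 by ring, katetov_succ]
    have hU : IsUnit (Ppoly q s (m + 1) 0).det := by
      rw [Ppoly_rec hs, ← Matrix.isUnit_iff_isUnit_det, IsUnit.neg_iff,
        Matrix.isUnit_iff_isUnit_det, Matrix.det_mul]
      exact (Matrix.isUnit_nonsing_inv_det _ (spd_unit hs)).mul hu
    have hinv : (Ppoly q s (m + 1) 0)⁻¹ = -((Qhat q (katetov1 q s) m 0)⁻¹ * s 0) := by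
      apply Matrix.inv_eq_left_inv
      rw [Ppoly_rec hs]
      simp only [neg_mul_neg]
      rw [mul_assoc, ← mul_assoc (s 0), Matrix.mul_nonsing_inv _ (spd_unit hs), one_mul,
        Matrix.nonsing_inv_mul _ hu]
    refine ⟨hU, fun j => ⟨?_, ?_⟩⟩
    · rw [hinv, DSL_eq hs, ← add_assoc, (h j).2, hk, Matrix.conjTranspose_neg,
        Matrix.conjTranspose_mul, spd_herm hs]
      simp only [mul_assoc, neg_mul, mul_neg, neg_neg]
    · rw [Ppoly_rec hs, ← add_assoc, DSM_succ hs, (h j).1, hk, Matrix.conjTranspose_neg,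
        Matrix.conjTranspose_mul, inv_herm hs]
      simp only [mul_assoc, neg_mul, mul_neg, neg_neg]

lemma PPmat_inv {q : ℕ} {P : Mq q} (hP : IsUnit P.det) :
    (Matrix.fromBlocks ((P⁻¹)ᴴ) 0 0 P : M2q q)⁻¹ = Matrix.fromBlocks Pᴴ 0 0 P⁻¹ := by
  apply Matrix.inv_eq_right_inv
  rw [Matrix.fromBlocks_multiply, ← Matrix.conjTranspose_mul]
  simp [Matrix.mul_nonsing_inv _ hP]

lemma QQ_inv {q : ℕ} {Q : Mq q} (hQ : IsUnit Q.det) {z : ℂ} (hz : z ≠ 0) :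
    (Matrix.fromBlocks 0 Q (-(z • (Q⁻¹)ᴴ)) 0 : M2q q)⁻¹ =
      Matrix.fromBlocks 0 (-(z⁻¹ • Qᴴ)) Q⁻¹ 0 := by
  apply Matrix.inv_eq_right_inv
  have h : (Q⁻¹)ᴴ * Qᴴ = 1 := by
    rw [← Matrix.conjTranspose_mul, Matrix.mul_nonsing_inv _ hQ, Matrix.conjTranspose_one]
  rw [Matrix.fromBlocks_multiply]
  simp [Matrix.mul_nonsing_inv _ hQ, h, smul_smul, hz]

/-- Conjugation relations for the elementary `2q×2q` factors. -/
theorem stmt8 (q : ℕ) (hq : 1 ≤ q) (s : ℕ → Mq q) (hs : IsStieltjesPD q s) (k m : ℕ) (hmk : m ≤ k) (z : ℂ) (hz : z ≠ 0) :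
    LL q s k = PPmat q s m * LL q (katetov q (2 * m) s) (k - m) * (PPmat q s m)⁻¹ ∧
      LL q s k =
        QQgen q s m z * MM q (katetov q (2 * m + 1) s) (k - m) z * (QQgen q s m z)⁻¹ ∧
      MM q s k z = PPmat q s m * MM q (katetov q (2 * m) s) (k - m) z * (PPmat q s m)⁻¹ ∧
      MM q s (k + 1) z =
        QQgen q s m z * LL q (katetov q (2 * m + 1) s) (k - m) * (QQgen q s m z)⁻¹ := by
  obtain ⟨j, rfl⟩ : ∃ j, k = j + m := ⟨k - m, by omega⟩
  rw [Nat.add_sub_cancel]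
  obtain ⟨hP, hE⟩ := even_rel m s hs
  obtain ⟨hQ, hO⟩ := odd_of_even (even_rel m) s hs
  have hPP : ((Ppoly q s m 0)⁻¹)ᴴ * (Ppoly q s m 0)ᴴ = 1 := by
    rw [← Matrix.conjTranspose_mul, Matrix.mul_nonsing_inv _ hP, Matrix.conjTranspose_one]
  have hQQ : ((Qhat q s m 0)⁻¹)ᴴ * (Qhat q s m 0)ᴴ = 1 := by
    rw [← Matrix.conjTranspose_mul, Matrix.mul_nonsing_inv _ hQ, Matrix.conjTranspose_one]
  refine ⟨?_, ?_, ?_, ?_⟩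
  · rw [LL, LL, PPmat, PPmat_inv hP, (hE j).1]
    simp [Matrix.fromBlocks_multiply, Matrix.mul_nonsing_inv _ hP, hPP]
  · rw [LL, MM, QQgen, QQ_inv hQ hz, (hO j).1]
    simp [Matrix.fromBlocks_multiply, Matrix.mul_nonsing_inv _ hQ, hQQ, smul_smul, hz]
  · rw [MM, MM, PPmat, PPmat_inv hP, (hE j).2]
    simp [Matrix.fromBlocks_multiply, Matrix.mul_nonsing_inv _ hP, hPP]
  · rw [MM, LL, QQgen, QQ_inv hQ hz, (hO j).2]
    simp [Matrix.fromBlocks_multiply, Matrix.mul_nonsing_inv _ hQ, hQQ, smul_smul, hz]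

end
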